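/- Let (S, wt) be a full passport with N = |S| and define NP_+(S') := Σ_{𝔮 ∈ 𝔓(S')} (−1)^{|𝔮|−1} X(𝔮) for any zero-sum subset S' ⊆ S. Then Σ_{𝔭 = {S_1,…,S_n} ∈ 𝔓(S)} (n−1)! · ∏_{i=1}^{n} NP_+(S_i) = (N−1)!. -/

import Mathlib

open Finset

/-- Cumulative sums of a permutation (linear ordering) of a finite subset `B`
with respect to the weight `wt`: `cumSumOn wt B P i = H_i`. -/
noncomputable def cumSumOn {α : Type*} (wt : α → ℝ) (B : Finset α)
    (P : Fin B.card ≃ {x // x ∈ B}) (i : ℕ) : ℝ :=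
  ∑ j ∈ Finset.univ.filter (fun j : Fin B.card => (j : ℕ) < i), wt (P j : α)

/-- A positive permutation of `B`: all proper cumulative sums are positive. -/
def PosPermOn {α : Type*} (wt : α → ℝ) (B : Finset α)
    (P : Fin B.card ≃ {x // x ∈ B}) : Prop :=
  ∀ i, 1 ≤ i → i ≤ B.card - 1 → 0 < cumSumOn wt B P i

/-- A tree permutation of `B`: (1) `H_i ≠ 0` for `1 ≤ i ≤ |B|-1`;
(2) whenever `H_{k-1} = H_l > 0` (`1 ≤ k < l ≤ |B|`), `min{H_k,…,H_{l-1}} < H_l`;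
(3) whenever `H_{k-1} = H_l < 0` (`1 ≤ k < l ≤ |B|`), `max{H_k,…,H_{l-1}} > H_l`. -/
def TreePermOn {α : Type*} (wt : α → ℝ) (B : Finset α)
    (P : Fin B.card ≃ {x // x ∈ B}) : Prop :=
  (∀ i, 1 ≤ i → i ≤ B.card - 1 → cumSumOn wt B P i ≠ 0) ∧
  (∀ k l, 1 ≤ k → k < l → l ≤ B.card →
    cumSumOn wt B P (k - 1) = cumSumOn wt B P l → 0 < cumSumOn wt B P l →
    ∃ t, k ≤ t ∧ t < l ∧ cumSumOn wt B P t < cumSumOn wt B P l) ∧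
  (∀ k l, 1 ≤ k → k < l → l ≤ B.card →
    cumSumOn wt B P (k - 1) = cumSumOn wt B P l → cumSumOn wt B P l < 0 →
    ∃ t, k ≤ t ∧ t < l ∧ cumSumOn wt B P l < cumSumOn wt B P t)

/-- `|P_+(B, wt)|`: the number of positive permutations of `B`. -/
noncomputable def numPos {α : Type*} (wt : α → ℝ) (B : Finset α) : ℕ :=
  Nat.card {P : Fin B.card ≃ {x // x ∈ B} // PosPermOn wt B P}

/-- `|PT_+(B, wt)|`: the number of positive tree permutations of `B`. -/
noncomputable def numPosTree {α : Type*} (wt : α → ℝ) (B : Finset α) : ℕ :=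
  Nat.card {P : Fin B.card ≃ {x // x ∈ B} // PosPermOn wt B P ∧ TreePermOn wt B P}

/-- `𝔭` is a partition of `S'` into nonempty zero-sum blocks. -/
def IsPart {α : Type*} (wt : α → ℝ) (S' : Finset α) (𝔭 : Finset (Finset α)) : Prop :=
  (∀ B ∈ 𝔭, B.Nonempty) ∧ (∀ B ∈ 𝔭, B ⊆ S') ∧
  (∀ a ∈ S', ∃! B, B ∈ 𝔭 ∧ a ∈ B) ∧ (∀ B ∈ 𝔭, ∑ s ∈ B, wt s = 0)

/-- `X(𝔭) = ∏_{B ∈ 𝔭} (|B| - 1)!`. -/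
def Xval {α : Type*} (𝔭 : Finset (Finset α)) : ℕ :=
  ∏ B ∈ 𝔭, Nat.factorial (B.card - 1)

open Classical in
/-- `NP_+(B) = Σ_{𝔮 ∈ 𝔓(B)} (−1)^{|𝔮|−1} X(𝔮)`. -/
noncomputable def NPplus {α : Type*} [Fintype α] (wt : α → ℝ) (B : Finset α) : ℝ :=
  ∑ 𝔮 ∈ Finset.univ.filter (IsPart wt B), (-1 : ℝ) ^ (𝔮.card - 1) * (Xval 𝔮 : ℝ)

section ZeroSumPartitions

open Classical

variable {α : Type*} {wt : α → ℝ} {A B : Finset α} {p : Finset (Finset α)}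

lemma IsPart.eq_of_mem (hp : IsPart wt A p) {C : Finset α} (hB : B ∈ p) (hC : C ∈ p) {a : α}
    (haB : a ∈ B) (haC : a ∈ C) : B = C :=
  (hp.2.2.1 a (hp.2.1 B hB haB)).unique ⟨hB, haB⟩ ⟨hC, haC⟩

lemma IsPart.sum_eq_zero (hp : IsPart wt A p) : ∑ s ∈ A, wt s = 0 := by
  have hA : A = p.biUnion id := by
    ext a
    simp only [mem_biUnion, id]
    exact ⟨fun ha => (hp.2.2.1 a ha).exists, fun ⟨B, hB, ha⟩ => hp.2.1 B hB ha⟩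
  rw [hA, sum_biUnion]
  · exact Finset.sum_eq_zero fun B hB => hp.2.2.2 B hB
  · intro B hB C hC hBC
    refine disjoint_left.2 fun a haB haC => hBC (hp.eq_of_mem hB hC haB haC)

lemma isPart_empty_iff : IsPart wt ∅ p ↔ p = ∅ := by
  constructor
  · intro hp
    refine eq_empty_of_forall_notMem fun B hB => ?_
    exact (hp.1 B hB).ne_empty (subset_empty.1 (hp.2.1 B hB))
  · rintro rfl
    simp [IsPart]

lemma IsPart.nonempty (hp : IsPart wt A p) (hA : A.Nonempty) : p.Nonempty := by
  obtain ⟨a, ha⟩ := hA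
  obtain ⟨B, hB, -⟩ := (hp.2.2.1 a ha).exists
  exact ⟨B, hB⟩

lemma IsPart.erase (hp : IsPart wt A p) (hB : B ∈ p) : IsPart wt (A \ B) (p.erase B) := by
  refine ⟨fun C hC => hp.1 C (mem_of_mem_erase hC), fun C hC a ha => ?_, fun a ha => ?_,
    fun C hC => hp.2.2.2 C (mem_of_mem_erase hC)⟩
  · rw [mem_erase] at hC
    exact mem_sdiff.2 ⟨hp.2.1 C hC.2 ha, fun haB => hC.1 (hp.eq_of_mem hC.2 hB ha haB)⟩
  · rw [mem_sdiff] at ha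
    obtain ⟨C, ⟨hC, haC⟩, -⟩ := hp.2.2.1 a ha.1
    refine ⟨C, ⟨mem_erase.2 ⟨fun h => ha.2 (h ▸ haC), hC⟩, haC⟩, ?_⟩
    rintro D ⟨hD, haD⟩
    exact hp.eq_of_mem (mem_of_mem_erase hD) hC haD haC

lemma IsPart.notMem_of_sdiff (hp : IsPart wt (A \ B) p) (hB : B.Nonempty) : B ∉ p := by
  obtain ⟨a, ha⟩ := hB
  exact fun h => (mem_sdiff.1 (hp.2.1 B h ha)).2 ha

lemma IsPart.insert_of_sdiff (hp : IsPart wt (A \ B) p) (hBA : B ⊆ A) (hB : B.Nonempty)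
    (h0 : ∑ s ∈ B, wt s = 0) : IsPart wt A (insert B p) := by
  refine ⟨by simpa using ⟨hB, hp.1⟩, ?_, fun a ha => ?_, by simpa using ⟨h0, hp.2.2.2⟩⟩
  · simpa using ⟨hBA, fun C hC => (hp.2.1 C hC).trans sdiff_subset⟩
  · by_cases haB : a ∈ B
    · refine ⟨B, ⟨mem_insert_self _ _, haB⟩, ?_⟩
      rintro C ⟨hC, haC⟩
      rcases mem_insert.1 hC with h | h
      · exact h
      · exact absurd haB (mem_sdiff.1 (hp.2.1 C h haC)).2
    · obtain ⟨C, ⟨hC, haC⟩, -⟩ := hp.2.2.1 a (mem_sdiff.2 ⟨ha, haB⟩)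
      refine ⟨C, ⟨mem_insert_of_mem hC, haC⟩, ?_⟩
      rintro D ⟨hD, haD⟩
      rcases mem_insert.1 hD with h | h
      · exact absurd (h ▸ haD) haB
      · exact hp.eq_of_mem h hC haD haC

variable [Fintype α]

/-- Summing over a zero-sum partition with a marked block is the same as summing over the marked
block and a zero-sum partition of its complement. -/
lemma sum_isPart_sum_block (wt : α → ℝ) (A : Finset α)
    (φ : Finset α → Finset (Finset α) → ℝ) :
    ∑ p with IsPart wt A p, ∑ B ∈ p, φ B (p.erase B) =
      ∑ B ∈ A.powerset with B.Nonempty ∧ ∑ s ∈ B, wt s = 0,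
        ∑ p with IsPart wt (A \ B) p, φ B p := by
  rw [sum_sigma', sum_sigma']
  refine sum_bij' (fun x _ => ⟨x.2, x.1.erase x.2⟩) (fun x _ => ⟨insert x.1 x.2, x.1⟩)
    ?_ ?_ ?_ ?_ ?_
  · rintro ⟨p, B⟩ h
    simp only [mem_sigma, mem_filter, mem_univ, true_and, mem_powerset] at h ⊢
    exact ⟨⟨h.1.2.1 B h.2, h.1.1 B h.2, h.1.2.2.2 B h.2⟩, h.1.erase h.2⟩
  · rintro ⟨B, p⟩ h
    simp only [mem_sigma, mem_filter, mem_univ, true_and, mem_powerset] at h ⊢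
    exact ⟨h.2.insert_of_sdiff h.1.1 h.1.2.1 h.1.2.2, mem_insert_self _ _⟩
  · rintro ⟨p, B⟩ h
    simp only [mem_sigma] at h
    simp [insert_erase h.2]
  · rintro ⟨B, p⟩ h
    simp only [mem_sigma, mem_filter, mem_univ, true_and, mem_powerset] at h
    simp [erase_insert (h.2.notMem_of_sdiff h.1.2.1)]
  · rintro ⟨p, B⟩ _
    rfl

/-- Sum over zero-sum partitions of a multiplicative weight times a function of the number of
blocks. -/
noncomputable def partSum (wt : α → ℝ) (w : ℕ → ℝ) (g : Finset α → ℝ) (A : Finset α) : ℝ :=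
  ∑ p with IsPart wt A p, w p.card * ∏ B ∈ p, g B

lemma partSum_empty (w : ℕ → ℝ) (g : Finset α → ℝ) : partSum wt w g ∅ = w 0 := by
  simp [partSum, isPart_empty_iff, Finset.filter_eq']

lemma partSum_eq_zero (w : ℕ → ℝ) (g : Finset α → ℝ) (hA : ∑ s ∈ A, wt s ≠ 0) :
    partSum wt w g A = 0 := by
  unfold partSum
  rw [filter_false_of_mem, sum_empty]
  exact fun p _ hp => hA hp.sum_eq_zero

/-- Removing the block that contains a given element. -/
lemma partSum_eq_sum_mem (w : ℕ → ℝ) (g : Finset α → ℝ) {a : α} (ha : a ∈ A) :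
    partSum wt w g A = ∑ B ∈ A.powerset with a ∈ B ∧ ∑ s ∈ B, wt s = 0,
      g B * partSum wt (fun n => w (n + 1)) g (A \ B) := by
  have key := sum_isPart_sum_block wt A fun B p =>
    if a ∈ B then g B * (w (p.card + 1) * ∏ C ∈ p, g C) else 0
  have hl : partSum wt w g A = ∑ p with IsPart wt A p, ∑ B ∈ p,
      if a ∈ B then g B * (w ((p.erase B).card + 1) * ∏ C ∈ p.erase B, g C) else 0 := by
    refine sum_congr rfl fun p hp => ?_
    have hp : IsPart wt A p := (mem_filter.1 hp).2
    obtain ⟨B, ⟨hB, haB⟩, -⟩ := hp.2.2.1 a ha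
    rw [sum_eq_single_of_mem B hB, if_pos haB, card_erase_add_one hB,
      ← mul_prod_erase p g hB]
    · ring
    · intro C hC hCB
      exact if_neg fun haC => hCB (hp.eq_of_mem hC hB haC haB)
  rw [hl, key, sum_filter, sum_filter]
  refine sum_congr rfl fun B _ => ?_
  by_cases haB : a ∈ B
  · have : B.Nonempty := ⟨a, haB⟩
    simp [haB, this, partSum, mul_sum]
  · simp [haB]

/-- Removing an arbitrary block from an ordered zero-sum partition. -/
lemma partSum_factorial (g : Finset α → ℝ) (hA : A.Nonempty) :
    partSum wt (fun n => (n.factorial : ℝ)) g A =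
      ∑ B ∈ A.powerset with B.Nonempty ∧ ∑ s ∈ B, wt s = 0,
        g B * partSum wt (fun n => (n.factorial : ℝ)) g (A \ B) := by
  simp only [partSum, mul_sum]
  rw [← sum_isPart_sum_block wt A fun B p => g B * ((p.card.factorial : ℝ) * ∏ C ∈ p, g C)]
  refine sum_congr rfl fun p hp => ?_
  have hp : IsPart wt A p := (mem_filter.1 hp).2
  have h : ∀ B ∈ p, g B * (((p.erase B).card.factorial : ℝ) * ∏ C ∈ p.erase B, g C) =
      ((p.card - 1).factorial : ℝ) * ∏ C ∈ p, g C := fun B hB => by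
    rw [card_erase_of_mem hB, ← mul_prod_erase p g hB]
    ring
  rw [sum_congr rfl h, sum_const, nsmul_eq_mul,
    ← Nat.mul_factorial_pred (card_pos.2 (hp.nonempty hA)).ne']
  push_cast
  ring

/-- The signed sum of `Xval` over zero-sum partitions, normalised to be `1` on the empty set. -/
noncomputable def signedSum (wt : α → ℝ) : Finset α → ℝ :=
  partSum wt (fun _ => 1) fun B => -((B.card - 1).factorial : ℝ)

lemma NPplus_eq_neg_signedSum (hA : A.Nonempty) : NPplus wt A = -signedSum wt A := by
  unfold NPplus signedSum partSum
  rw [← sum_neg_distrib]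
  refine sum_congr rfl fun p hp => ?_
  have hp : IsPart wt A p := (mem_filter.1 hp).2
  obtain ⟨n, hn⟩ := Nat.exists_eq_succ_of_ne_zero (card_pos.2 (hp.nonempty hA)).ne'
  rw [prod_neg, hn, Xval]
  push_cast
  simp [pow_succ]

lemma sum_signedSum_mul (hA : A.Nonempty) :
    ∑ B ∈ A.powerset, signedSum wt B *
      partSum wt (fun n => (n.factorial : ℝ)) (NPplus wt) (A \ B) = 0 := by
  rw [← add_sum_erase _ _ (empty_mem_powerset A), sdiff_empty, partSum_factorial _ hA, sum_filter,
    ← add_sum_erase _ _ (empty_mem_powerset A)]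
  simp only [signedSum, partSum_empty, Finset.not_nonempty_empty, false_and, if_false, zero_add, one_mul]
  rw [← sum_add_distrib]
  refine Finset.sum_eq_zero fun B hB => ?_
  have hB : B.Nonempty := nonempty_iff_ne_empty.2 (mem_erase.1 hB).1
  by_cases h0 : ∑ s ∈ B, wt s = 0
  · rw [if_pos ⟨hB, h0⟩, NPplus_eq_neg_signedSum hB, signedSum]
    ring
  · simp [h0, partSum_eq_zero _ _ h0]

/-- The logarithm of the exponential formula: cyclically arranged zero-sum partitions weighted by
`NPplus` recover the factorial weight. -/
lemma partSum_NPplus (hA : A.Nonempty) (h0 : ∑ s ∈ A, wt s = 0) :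
    partSum wt (fun n => ((n - 1).factorial : ℝ)) (NPplus wt) A = ((A.card - 1).factorial : ℝ) := by
  obtain ⟨a, ha⟩ := hA
  set K := partSum wt (fun n => (n.factorial : ℝ)) (NPplus wt) with hK
  set P : Finset α → Prop := fun C => a ∈ C ∧ ∑ s ∈ C, wt s = 0 with hP
  have hL : partSum wt (fun n => ((n - 1).factorial : ℝ)) (NPplus wt) A =
      ∑ B ∈ A.powerset with a ∈ B, ∑ C ∈ B.powerset with P C,
        ((C.card - 1).factorial : ℝ) * (signedSum wt (B \ C) * K (A \ B)) := by
    rw [partSum_eq_sum_mem _ _ ha, sum_filter, sum_filter]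
    refine sum_congr rfl fun B _ => ?_
    by_cases haB : a ∈ B
    · have hE := partSum_eq_sum_mem (wt := wt) (fun _ => 1)
        (fun B => -((B.card - 1).factorial : ℝ)) haB
      have hE' : ∑ C ∈ B.powerset with P C,
          ((C.card - 1).factorial : ℝ) * (signedSum wt (B \ C) * K (A \ B)) =
          -signedSum wt B * K (A \ B) := by
        rw [signedSum, hE, ← sum_neg_distrib, sum_mul]
        exact sum_congr rfl fun C _ => by ring
      rw [if_pos haB, hE']
      by_cases hB0 : ∑ s ∈ B, wt s = 0
      · rw [if_pos ⟨haB, hB0⟩, NPplus_eq_neg_signedSum ⟨a, haB⟩]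
        simp [hK]
      · simp [hB0, signedSum, partSum_eq_zero _ _ hB0]
    · simp [haB]
  have hswap : ∑ B ∈ A.powerset with a ∈ B, ∑ C ∈ B.powerset with P C,
        ((C.card - 1).factorial : ℝ) * (signedSum wt (B \ C) * K (A \ B)) =
      ∑ C ∈ A.powerset with P C, ∑ D ∈ (A \ C).powerset,
        ((C.card - 1).factorial : ℝ) * (signedSum wt D * K ((A \ C) \ D)) := by
    rw [sum_sigma', sum_sigma']
    refine sum_bij' (fun x _ => ⟨x.2, x.1 \ x.2⟩) (fun x _ => ⟨x.1 ∪ x.2, x.1⟩) ?_ ?_ ?_ ?_ ?_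
    · rintro ⟨B, C⟩ h
      simp only [mem_sigma, mem_filter, mem_powerset] at h ⊢
      exact ⟨⟨h.2.1.trans h.1.1, h.2.2⟩, sdiff_subset_sdiff h.1.1 subset_rfl⟩
    · rintro ⟨C, D⟩ h
      simp only [mem_sigma, mem_filter, mem_powerset] at h ⊢
      exact ⟨⟨union_subset h.1.1 (h.2.trans sdiff_subset), mem_union_left _ h.1.2.1⟩,
        subset_union_left, h.1.2⟩
    · rintro ⟨B, C⟩ h
      simp only [mem_sigma, mem_filter, mem_powerset] at h
      simp [union_sdiff_of_subset h.2.1]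
    · rintro ⟨C, D⟩ h
      simp only [mem_sigma, mem_filter, mem_powerset] at h
      have : Disjoint C D := disjoint_of_subset_right h.2 disjoint_sdiff
      simp [union_sdiff_cancel_left this]
    · rintro ⟨B, C⟩ h
      simp only [mem_sigma, mem_filter, mem_powerset] at h
      have : (A \ C) \ (B \ C) = A \ B := by
        have := h.2.1
        grind
      simp only [this]
  rw [hL, hswap, sum_eq_single_of_mem A (by simp [hP, ha, h0])]
  · simp [hK, signedSum, partSum_empty]
  · intro C hC hCA
    rw [← mul_sum, hK, sum_signedSum_mul, mul_zero]
    exact sdiff_nonempty.2 fun h =>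
      hCA ((mem_powerset.1 (mem_filter.1 hC).1).antisymm h)

end ZeroSumPartitions

open Classical in
theorem stmt_15 {α : Type*} [Fintype α] (wt : α → ℝ)
    (hwt : ∀ s, wt s ≠ 0) (hsum : ∑ s, wt s = 0) (hcard : 2 ≤ Fintype.card α) :
    (∑ 𝔭 ∈ Finset.univ.filter (IsPart wt Finset.univ),
      (Nat.factorial (𝔭.card - 1) : ℝ) * ∏ B ∈ 𝔭, NPplus wt B) =
      (Nat.factorial (Fintype.card α - 1) : ℝ) := by
  have : Nonempty α := Fintype.card_pos_iff.1 (by omega)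
  exact partSum_NPplus univ_nonempty hsum
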